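/- arXiv:math/0312224 — 2 statements merged into one kernel-verified Lean document; each statement's English description precedes it below -/
import Mathlib

section
/- Let x, y, θ : ℝ → ℝ be twice differentiable functions with y(t) > 0 for all t, satisfying x'(t) + y(t)·θ'(t) = 0 and x'(t)² + y'(t)² ≠ 0 for all t. Set u(t) = y(t) cos θ(t) and v(t) = y(t) sin θ(t). Then for all t: (u'(t)·v''(t) − u''(t)·v'(t)) / (u'(t)² + v'(t)²) = θ'(t) + (x'(t)·y''(t) − y'(t)·x''(t)) / (x'(t)² + y'(t)²). -/
open Real in
/-- Let `x, y, θ : ℝ → ℝ` be twice differentiable with `y > 0`, satisfying the Legendrian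
condition `x' + y·θ' = 0` and the regularity condition `x'² + y'² ≠ 0`. With
`u = y·cos θ` and `v = y·sin θ`, the Gauss map integrands satisfy
`(u'·v'' − u''·v')/(u'² + v'²) = θ' + (x'·y'' − y'·x'')/(x'² + y'²)` everywhere. -/
theorem gauss_map_integrand_decomposition
    (x y θ u v : ℝ → ℝ)
    (hx : Differentiable ℝ x) (hx' : Differentiable ℝ (deriv x))
    (hy : Differentiable ℝ y) (hy' : Differentiable ℝ (deriv y))
    (hθ : Differentiable ℝ θ) (hθ' : Differentiable ℝ (deriv θ))
    (hypos : ∀ t, 0 < y t)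
    (hLeg : ∀ t, deriv x t + y t * deriv θ t = 0)
    (hreg : ∀ t, (deriv x t) ^ 2 + (deriv y t) ^ 2 ≠ 0)
    (hu : ∀ t, u t = y t * Real.cos (θ t))
    (hv : ∀ t, v t = y t * Real.sin (θ t)) :
    ∀ t, (deriv u t * deriv (deriv v) t - deriv (deriv u) t * deriv v t) /
        ((deriv u t) ^ 2 + (deriv v t) ^ 2) =
      deriv θ t + (deriv x t * deriv (deriv y) t - deriv y t * deriv (deriv x) t) /
        ((deriv x t) ^ 2 + (deriv y t) ^ 2) := by
  have hu' : deriv u = fun t => deriv y t * cos (θ t) + deriv x t * sin (θ t) := by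
    funext t
    rw [funext hu, ((hy t).hasDerivAt.fun_mul (hθ t).hasDerivAt.cos).deriv]
    linear_combination -sin (θ t) * hLeg t
  have hv' : deriv v = fun t => deriv y t * sin (θ t) - deriv x t * cos (θ t) := by
    funext t
    rw [funext hv, ((hy t).hasDerivAt.fun_mul (hθ t).hasDerivAt.sin).deriv]
    linear_combination cos (θ t) * hLeg t
  intro t
  have hcos := (hθ t).hasDerivAt.cos
  have hsin := (hθ t).hasDerivAt.sin
  have hu'' := (((hy' t).hasDerivAt.fun_mul hcos).fun_add ((hx' t).hasDerivAt.fun_mul hsin)).deriv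
  have hv'' := (((hy' t).hasDerivAt.fun_mul hsin).fun_sub ((hx' t).hasDerivAt.fun_mul hcos)).deriv
  have hpyth := sin_sq_add_cos_sq (θ t)
  have hspeed : deriv u t ^ 2 + deriv v t ^ 2 = deriv x t ^ 2 + deriv y t ^ 2 := by
    rw [hu', hv']
    linear_combination (deriv x t ^ 2 + deriv y t ^ 2) * hpyth
  have hnum : deriv u t * deriv (deriv v) t - deriv (deriv u) t * deriv v t =
      deriv θ t * (deriv x t ^ 2 + deriv y t ^ 2) +
        (deriv x t * deriv (deriv y) t - deriv y t * deriv (deriv x) t) := by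
    rw [hu', hv', hu'', hv'']
    linear_combination (deriv θ t * (deriv x t ^ 2 + deriv y t ^ 2) +
      (deriv x t * deriv (deriv y) t - deriv y t * deriv (deriv x) t)) * hpyth
  rw [hspeed, hnum, add_div, mul_div_cancel_right₀ _ (hreg t)]
end

section
/- Let T > 0 and let x, y, θ : ℝ → ℝ be twice continuously differentiable functions with y(t) > 0, x'(t) + y(t)·θ'(t) = 0, and x'(t)² + y'(t)² ≠ 0 for all t. Set u(t) = y(t) cos θ(t), v(t) = y(t) sin θ(t). Then (1/2π) ∫₀ᵀ (u'v'' − u''v') / ((u')² + (v')²) dt = (θ(T) − θ(0))/2π + (1/2π) ∫₀ᵀ (x'y'' − y'x'') / ((x')² + (y')²) dt. -/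
open intervalIntegral Real

/-- Rotating the vector `(q, -p)` by the angle `θ` adds `θ'` to its angular velocity. -/
lemma angular_velocity_rotate (p q p' q' θ' c s : ℝ) (hcs : s ^ 2 + c ^ 2 = 1)
    (hpq : p ^ 2 + q ^ 2 ≠ 0) :
    ((q * c + p * s) * (q' * s + q * (c * θ') - (p' * c + p * (-s * θ'))) -
        (q' * c + q * (-s * θ') + (p' * s + p * (c * θ'))) * (q * s - p * c)) /
      ((q * c + p * s) ^ 2 + (q * s - p * c) ^ 2) =
    θ' + (p * q' - q * p') / (p ^ 2 + q ^ 2) := by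
  have hden : (q * c + p * s) ^ 2 + (q * s - p * c) ^ 2 = p ^ 2 + q ^ 2 := by
    linear_combination (p ^ 2 + q ^ 2) * hcs
  rw [hden]
  field_simp
  linear_combination (θ' * (p ^ 2 + q ^ 2) + p * q' - q * p') * hcs

/-- Let `T > 0` and let `x, y, θ : ℝ → ℝ` be twice continuously differentiable with `y > 0`,
`x' + y·θ' = 0` (Legendrian condition) and `x'² + y'² ≠ 0` (regularity). With
`u = y·cos θ`, `v = y·sin θ`, the degree integrand of the Gauss map of `(u, v)` integrates to
`(θ(T) − θ(0))/2π` plus the corresponding integral for `(x, y)`; this is the analytic form of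
`μ(L) = r(L) + h(L)`. -/
theorem maslov_index_eq_rotation_plus_homology
    (T : ℝ) (hT : 0 < T)
    (x y θ u v : ℝ → ℝ)
    (hx : ContDiff ℝ 2 x) (hy : ContDiff ℝ 2 y) (hθ : ContDiff ℝ 2 θ)
    (hypos : ∀ t, 0 < y t)
    (hLeg : ∀ t, deriv x t + y t * deriv θ t = 0)
    (hreg : ∀ t, (deriv x t) ^ 2 + (deriv y t) ^ 2 ≠ 0)
    (hu : ∀ t, u t = y t * Real.cos (θ t))
    (hv : ∀ t, v t = y t * Real.sin (θ t)) :
    (1 / (2 * π)) * ∫ t in (0 : ℝ)..T,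
        (deriv u t * deriv (deriv v) t - deriv (deriv u) t * deriv v t) /
          ((deriv u t) ^ 2 + (deriv v t) ^ 2) =
      (θ T - θ 0) / (2 * π) +
        (1 / (2 * π)) * ∫ t in (0 : ℝ)..T,
          (deriv x t * deriv (deriv y) t - deriv y t * deriv (deriv x) t) /
            ((deriv x t) ^ 2 + (deriv y t) ^ 2) := by
  have hx' : ContDiff ℝ 1 (deriv x) :=
    ContDiff.deriv' (by norm_num [one_add_one_eq_two, hx])
  have hy' : ContDiff ℝ 1 (deriv y) :=
    ContDiff.deriv' (by norm_num [one_add_one_eq_two, hy])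
  have hθ' : Continuous (deriv θ) := hθ.continuous_deriv (by norm_num)
  have hx'' : Continuous (deriv (deriv x)) := hx'.continuous_deriv le_rfl
  have hy'' : Continuous (deriv (deriv y)) := hy'.continuous_deriv le_rfl
  have dθ (t : ℝ) : HasDerivAt θ (deriv θ t) t :=
    (hθ.differentiable (by norm_num) t).hasDerivAt
  have dy (t : ℝ) : HasDerivAt y (deriv y t) t :=
    (hy.differentiable (by norm_num) t).hasDerivAt
  have dx' (t : ℝ) : HasDerivAt (deriv x) (deriv (deriv x) t) t :=
    (hx'.differentiable (by norm_num) t).hasDerivAt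
  have dy' (t : ℝ) : HasDerivAt (deriv y) (deriv (deriv y) t) t :=
    (hy'.differentiable (by norm_num) t).hasDerivAt
  have hu' : deriv u = fun t => deriv y t * cos (θ t) + deriv x t * sin (θ t) := by
    rw [funext hu]
    funext t
    refine ((dy t).mul (dθ t).cos).deriv.trans ?_
    linear_combination -sin (θ t) * hLeg t
  have hv' : deriv v = fun t => deriv y t * sin (θ t) - deriv x t * cos (θ t) := by
    rw [funext hv]
    funext t
    refine ((dy t).mul (dθ t).sin).deriv.trans ?_
    linear_combination cos (θ t) * hLeg t
  have hu'' (t : ℝ) := (((dy' t).mul (dθ t).cos).add ((dx' t).mul (dθ t).sin)).deriv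
  have hv'' (t : ℝ) := (((dy' t).mul (dθ t).sin).sub ((dx' t).mul (dθ t).cos)).deriv
  have hint (t : ℝ) :
      (deriv u t * deriv (deriv v) t - deriv (deriv u) t * deriv v t) /
          ((deriv u t) ^ 2 + (deriv v t) ^ 2) =
        deriv θ t + (deriv x t * deriv (deriv y) t - deriv y t * deriv (deriv x) t) /
          ((deriv x t) ^ 2 + (deriv y t) ^ 2) := by
    rw [hu', hv', ← angular_velocity_rotate _ _ _ _ _ _ _ (sin_sq_add_cos_sq (θ t)) (hreg t)]
    congr 3
    · exact hv'' t
    · exact hu'' t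
  have hrot : Continuous fun t =>
      (deriv x t * deriv (deriv y) t - deriv y t * deriv (deriv x) t) /
        ((deriv x t) ^ 2 + (deriv y t) ^ 2) :=
    ((hx'.continuous.mul hy'').sub (hy'.continuous.mul hx'')).div
      ((hx'.continuous.pow 2).add (hy'.continuous.pow 2)) hreg
  simp_rw [hint]
  rw [integral_add (hθ'.intervalIntegrable _ _) (hrot.intervalIntegrable _ _),
    integral_eq_sub_of_hasDerivAt (fun t _ => dθ t) (hθ'.intervalIntegrable _ _)]
  ring
end
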